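/- arXiv:1510.03670 — 2 statements merged into one kernel-verified Lean document; each statement's English description precedes it below -/
import Mathlib

section
/- Let m ≥ 2q^2 - 2q - 2 and let x^a y^b ∈ B be a monomial with m+1 ≤ aq + b(q+1) ≤ m+q+1. If D ⊆ E is the support of a nonzero codeword of C_m and x^a y^b belongs to the sous-escalier N(In_≺(I_D)), then |D| ≥ aq + b(q+1) - (q^2 - q) + 1. -/
open MvPolynomial

noncomputable section

/-- The monomial `x^r y^s` in `F[x,y]`, where `x = X 0`, `y = X 1`. -/
def monoXY (F : Type) [Field F] (r s : ℕ) : MvPolynomial (Fin 2) F := X 0 ^ r * X 1 ^ s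

/-- The Hermitian polynomial `H = x^(q+1) - y^q - y`. -/
def Hpoly (F : Type) [Field F] (q : ℕ) : MvPolynomial (Fin 2) F :=
  X 0 ^ (q + 1) - X 1 ^ q - X 1

/-- Evaluation of a bivariate polynomial at a point of `F × F`. -/
def evalPt {F : Type} [Field F] (p : F × F) (f : MvPolynomial (Fin 2) F) : F :=
  MvPolynomial.eval ![p.1, p.2] f

/-- The vanishing ideal of a set of points `S ⊆ F × F`. -/
def vanIdeal (F : Type) [Field F] (S : Set (F × F)) : Ideal (MvPolynomial (Fin 2) F) where
  carrier := {f | ∀ p ∈ S, evalPt p f = 0}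
  add_mem' := by
    intro a b ha hb p hp
    have h1 := ha p hp
    have h2 := hb p hp
    simp only [evalPt] at h1 h2 ⊢
    simp [map_add, h1, h2]
  zero_mem' := by
    intro p hp
    simp [evalPt]
  smul_mem' := by
    intro c f hf p hp
    have h1 := hf p hp
    simp only [evalPt] at h1 ⊢
    simp [smul_eq_mul, map_mul, h1]

/-- The `DegRevLex` order with `y > x`, on exponent pairs `(a, b) ↔ x^a y^b`. -/
def precOrd : ℕ × ℕ → ℕ × ℕ → Prop := fun a b =>
  a.1 + a.2 < b.1 + b.2 ∨ (a.1 + a.2 = b.1 + b.2 ∧ a.2 < b.2)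

/-- The pair of exponents `(d 0, d 1)` of an exponent finsupp. -/
def expPair (d : Fin 2 →₀ ℕ) : ℕ × ℕ := (d 0, d 1)

/-- `x^r y^s` is the leading monomial of `f` with respect to the monomial order `lt`. -/
def IsLMwith {F : Type} [Field F] (lt : ℕ × ℕ → ℕ × ℕ → Prop)
    (f : MvPolynomial (Fin 2) F) (r s : ℕ) : Prop :=
  MvPolynomial.coeff (Finsupp.single 0 r + Finsupp.single 1 s) f ≠ 0 ∧
    ∀ d ∈ f.support, expPair d = (r, s) ∨ lt (expPair d) (r, s)

/-- The initial ideal of `I` w.r.t. the monomial order `lt`: the ideal generated by the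
leading monomials of the nonzero elements of `I`. -/
def initialIdealWith {F : Type} [Field F] (lt : ℕ × ℕ → ℕ × ℕ → Prop)
    (I : Ideal (MvPolynomial (Fin 2) F)) : Ideal (MvPolynomial (Fin 2) F) :=
  Ideal.span {g | ∃ f ∈ I, f ≠ 0 ∧ ∃ r s, IsLMwith lt f r s ∧ g = monoXY F r s}

/-- The set `E` of `F`-rational affine points of the Hermitian curve. -/
def Eset (F : Type) [Field F] (q : ℕ) : Set (F × F) :=
  {p | p.1 ^ (q + 1) = p.2 ^ q + p.2}

/-- The set `B` of (exponent pairs of) monomials. -/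
def Bset (q : ℕ) : Set (ℕ × ℕ) :=
  {p | (p.1 ≤ q ∧ p.2 ≤ q ^ 2 - q - 1) ∨ (p.1 = 0 ∧ q ^ 2 - q ≤ p.2 ∧ p.2 ≤ q ^ 2 - 1)}

/-- The Hermitian code `C_m` (as a set of vectors), for the enumeration `P` of `E`. -/
def codeSet (F : Type) [Field F] (q m : ℕ) (P : Fin (q ^ 3) → F × F) :
    Set (Fin (q ^ 3) → F) :=
  {c | ∀ r s : ℕ, r * q + s * (q + 1) ≤ m → ∑ i, c i * ((P i).1 ^ r * (P i).2 ^ s) = 0}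

/-- The weight of a codeword: the number of nonzero entries. -/
def wt {F : Type} [Field F] {n : ℕ} (c : Fin n → F) : ℕ := {i | c i ≠ 0}.ncard

/-- The support of a codeword, as a set of points of the curve. -/
def suppPts {F : Type} [Field F] {n : ℕ} (P : Fin n → F × F) (c : Fin n → F) :
    Set (F × F) :=
  P '' {i | c i ≠ 0}

end

noncomputable section HermitianMonomials

variable {F : Type} [Field F]

/-- The evaluation vector of the monomial `x^r y^s` at the points of `D`. -/
def monEval (D : Set (F × F)) (r s : ℕ) : D → F := fun p => p.1.1 ^ r * p.1.2 ^ s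

/-- Evaluation of bivariate polynomials at the points of `D`, as a linear map. -/
def evalOn (D : Set (F × F)) : MvPolynomial (Fin 2) F →ₗ[F] (D → F) :=
  LinearMap.pi fun p => (MvPolynomial.aeval ![p.1.1, p.1.2]).toLinearMap

theorem evalOn_apply (D : Set (F × F)) (f : MvPolynomial (Fin 2) F) (p : D) :
    evalOn D f p = evalPt p.1 f := by
  simp [evalOn, evalPt, MvPolynomial.aeval_eq_eval]

theorem evalOn_monoXY (D : Set (F × F)) (r s : ℕ) :
    evalOn D (monoXY F r s) = monEval D r s := by
  ext p
  simp [evalOn_apply, evalPt, monoXY, monEval]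

theorem monoXY_eq_monomial (r s : ℕ) :
    monoXY F r s = monomial (Finsupp.single 0 r + Finsupp.single 1 s) 1 := by
  rw [monoXY, X_pow_eq_monomial, X_pow_eq_monomial, monomial_mul, one_mul]

theorem monEval_mul (D : Set (F × F)) (r s r' s' : ℕ) :
    monEval D r s * monEval D r' s' = monEval D (r + r') (s + s') := by
  ext p
  simp only [monEval, Pi.mul_apply]
  ring

theorem monEval_reduce {q : ℕ} {D : Set (F × F)} (hD : D ⊆ Eset F q) (r s : ℕ) :
    monEval D (r + (q + 1)) s = monEval D r (s + q) + monEval D r (s + 1) := by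
  ext p
  have h : p.1.1 ^ (q + 1) = p.1.2 ^ q + p.1.2 := hD p.2
  simp only [monEval, Pi.add_apply]
  rw [pow_add p.1.1 r, h]
  ring

/-- A functional killing the reduced monomials of weight `< w` kills all monomials of
weight `< w`. -/
theorem dual_eq_zero_of_reduced {q w : ℕ} (hq : 2 ≤ q) {D : Set (F × F)} (hD : D ⊆ Eset F q)
    (ψ : Module.Dual F (D → F))
    (h : ∀ r s, r ≤ q → r * q + s * (q + 1) < w → ψ (monEval D r s) = 0) :
    ∀ r s, r * q + s * (q + 1) < w → ψ (monEval D r s) = 0 := by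
  intro r
  induction r using Nat.strong_induction_on with
  | _ r ih =>
    intro s hw
    by_cases hr : r ≤ q
    · exact h r s hr hw
    · obtain ⟨t, rfl⟩ : ∃ t, r = t + (q + 1) := ⟨r - (q + 1), by omega⟩
      rw [monEval_reduce hD, map_add, ih t (by omega) _ (by nlinarith),
        ih t (by omega) _ (by nlinarith), add_zero]

theorem dual_monEval_shift {q w : ℕ} (hq : 2 ≤ q) {D : Set (F × F)} (hD : D ⊆ Eset F q)
    (ψ : Module.Dual F (D → F))
    (h : ∀ r s, r * q + s * (q + 1) < w → ψ (monEval D r s) = 0) (k : ℕ) :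
    ∀ r s, (r + k * (q + 1)) * q + s * (q + 1) = w →
      ψ (monEval D (r + k * (q + 1)) s) = ψ (monEval D r (s + k * q)) := by
  induction k with
  | zero => simp
  | succ k ih =>
    intro r s hw
    rw [show r + (k + 1) * (q + 1) = r + k * (q + 1) + (q + 1) by ring, monEval_reduce hD,
      map_add, h (r + k * (q + 1)) (s + 1) (by nlinarith), add_zero,
      ih r (s + q) (by rw [← hw]; ring)]
    congr 2
    ring

/-- If a functional kills all monomials of weight `< w`, its value at a monomial of weight `w`
depends only on `w`. -/
theorem dual_monEval_eq {q w : ℕ} (hq : 2 ≤ q) {D : Set (F × F)} (hD : D ⊆ Eset F q)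
    (ψ : Module.Dual F (D → F))
    (h : ∀ r s, r * q + s * (q + 1) < w → ψ (monEval D r s) = 0) {r s r' s' : ℕ}
    (hw : r * q + s * (q + 1) = w) (hw' : r' * q + s' * (q + 1) = w) :
    ψ (monEval D r s) = ψ (monEval D r' s') := by
  wlog hr : r' ≤ r generalizing r s r' s'
  · exact (this hw' hw (by omega)).symm
  obtain ⟨t, rfl⟩ := Nat.exists_eq_add_of_le hr
  have hs : s ≤ s' := by
    by_contra hs
    nlinarith [Nat.zero_le (t * q)]
  obtain ⟨u, rfl⟩ := Nat.exists_eq_add_of_le hs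
  have htu : t * q = u * (q + 1) := by nlinarith
  have hdvd : q + 1 ∣ t :=
    Nat.Coprime.dvd_of_dvd_mul_right (by simp) (Dvd.intro_left u htu.symm)
  obtain ⟨k, rfl⟩ := hdvd
  have hu : u = k * q := by
    apply Nat.eq_of_mul_eq_mul_right (Nat.succ_pos q)
    rw [Nat.succ_eq_add_one, ← htu]
    ring
  subst hu
  rw [mul_comm (q + 1) k]
  exact dual_monEval_shift hq hD ψ h k r' s (by rw [← hw]; ring)

/-- The integers `i ≤ w` such that both `i` and `w - i` lie in the semigroup generated by `q`
and `q + 1`. -/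
def semigroupPairs (q w : ℕ) : Finset ℕ :=
  {i ∈ Finset.range (w + 1) | i % q ≤ i / q ∧ (w - i) % q ≤ (w - i) / q}

theorem card_gaps_le (q w : ℕ) (hq : 0 < q) :
    2 * ({i ∈ Finset.range (w + 1) | i / q < i % q} : Finset ℕ).card ≤ q * (q - 1) := by
  have h : ({i ∈ Finset.range (w + 1) | i / q < i % q} : Finset ℕ).card ≤
      ((Finset.range q).sigma fun s => Finset.range s).card := by
    refine Finset.card_le_card_of_injOn (fun i => ⟨i % q, i / q⟩) ?_ ?_
    · intro i hi
      simp only [Finset.coe_filter, Set.mem_ofPred_eq] at hi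
      simp [hi.2, Nat.mod_lt _ hq]
    · intro i _ j _ hij
      simp only [Sigma.mk.injEq, heq_eq_eq] at hij
      rw [← Nat.div_add_mod i q, ← Nat.div_add_mod j q, hij.1, hij.2]
  rw [Finset.card_sigma] at h
  simp only [Finset.card_range] at h
  have h2 := Finset.sum_range_id_mul_two q
  omega

theorem le_card_semigroupPairs (q w : ℕ) (hq : 0 < q) :
    w + 1 ≤ (semigroupPairs q w).card + q * (q - 1) := by
  have hsub : Finset.range (w + 1) ⊆ semigroupPairs q w ∪
      (({i ∈ Finset.range (w + 1) | i / q < i % q} : Finset ℕ) ∪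
        ({i ∈ Finset.range (w + 1) | i / q < i % q} : Finset ℕ).image (w - ·)) := by
    intro i hi
    have hi' := Finset.mem_range.mp hi
    simp only [semigroupPairs, Finset.mem_union, Finset.mem_filter, Finset.mem_image]
    by_cases h1 : i / q < i % q
    · exact Or.inr (Or.inl ⟨hi, h1⟩)
    by_cases h2 : (w - i) / q < (w - i) % q
    · exact Or.inr (Or.inr ⟨w - i, ⟨Finset.mem_range.mpr (by omega), h2⟩, by omega⟩)
    · exact Or.inl ⟨hi, by omega, by omega⟩
  have h1 := Finset.card_le_card hsub
  rw [Finset.card_range] at h1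
  have h2 := Finset.card_union_le (semigroupPairs q w)
    (({i ∈ Finset.range (w + 1) | i / q < i % q} : Finset ℕ) ∪
      ({i ∈ Finset.range (w + 1) | i / q < i % q} : Finset ℕ).image (w - ·))
  have h3 := Finset.card_union_le ({i ∈ Finset.range (w + 1) | i / q < i % q} : Finset ℕ)
    (({i ∈ Finset.range (w + 1) | i / q < i % q} : Finset ℕ).image (w - ·))
  have h4 := Finset.card_image_le (s := ({i ∈ Finset.range (w + 1) | i / q < i % q} : Finset ℕ))
    (f := (w - ·))
  have h5 := card_gaps_le q w hq
  omega

theorem semigroup_weight {q i : ℕ} (hi : i % q ≤ i / q) :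
    (i / q - i % q) * q + (i % q) * (q + 1) = i := by
  obtain ⟨t, ht⟩ := Nat.exists_eq_add_of_le hi
  have h := Nat.div_add_mod i q
  rw [ht, Nat.add_sub_cancel_left]
  rw [ht] at h
  linarith

/-- The order bound: a functional killing the monomials of weight `< w` but not those of
weight `w` forces `D` to have at least `w + 1 - q (q - 1)` points. -/
theorem order_bound {q w : ℕ} (hq : 2 ≤ q) {D : Set (F × F)} [Finite D] (hD : D ⊆ Eset F q)
    (ψ : Module.Dual F (D → F))
    (h : ∀ r s, r * q + s * (q + 1) < w → ψ (monEval D r s) = 0)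
    {a b : ℕ} (hw : a * q + b * (q + 1) = w) (hab : ψ (monEval D a b) ≠ 0) :
    w + 1 ≤ D.ncard + q * (q - 1) := by
  have := Fintype.ofFinite D
  let v : ℕ → D → F := fun i => monEval D (i / q - i % q) (i % q)
  have hpair : ∀ i j, i % q ≤ i / q → j % q ≤ j / q →
      (i + j < w → ψ (v i * v j) = 0) ∧ (i + j = w → ψ (v i * v j) ≠ 0) := by
    intro i j hi hj
    have hwt : (i / q - i % q + (j / q - j % q)) * q + (i % q + j % q) * (q + 1) = i + j := by
      linarith [semigroup_weight hi, semigroup_weight hj]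
    simp only [v, monEval_mul]
    refine ⟨fun hlt => h _ _ (by omega), fun heq => ?_⟩
    rwa [dual_monEval_eq hq hD ψ h (hwt.trans heq) hw]
  have hli : LinearIndependent F (fun i : semigroupPairs q w => v i) := by
    classical
    rw [linearIndependent_iff']
    intro S g hg
    by_contra! hne
    obtain ⟨i₀, hi₀, hmax⟩ := Finset.exists_max_image (S.filter fun i => g i ≠ 0) (fun i => i.1)
      (by obtain ⟨i, hi, hi'⟩ := hne; exact ⟨i, by simp [hi, hi']⟩)
    rw [Finset.mem_filter] at hi₀
    have hmem : ∀ i : semigroupPairs q w, i.1 ≤ w ∧ i.1 % q ≤ i.1 / q ∧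
        (w - i.1) % q ≤ (w - i.1) / q := by
      intro i
      have hi := i.2
      simp only [semigroupPairs, Finset.mem_filter, Finset.mem_range] at hi
      exact ⟨by omega, hi.2⟩
    have hz : ψ ((∑ i ∈ S, g i • v i) * v (w - i₀.1)) = 0 := by rw [hg, zero_mul, map_zero]
    rw [Finset.sum_mul, map_sum, Finset.sum_eq_single_of_mem i₀ hi₀.1] at hz
    · rw [smul_mul_assoc, map_smul, smul_eq_mul, mul_eq_zero] at hz
      obtain ⟨hle, h1, h2⟩ := hmem i₀
      exact hz.elim hi₀.2 ((hpair _ _ h1 h2).2 (by omega))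
    · intro i hi hne'
      rw [smul_mul_assoc, map_smul, smul_eq_mul, mul_eq_zero]
      by_cases hgi : g i = 0
      · exact Or.inl hgi
      · have hle := hmax i (Finset.mem_filter.mpr ⟨hi, hgi⟩)
        have hlt : i.1 < i₀.1 := lt_of_le_of_ne hle fun h' => hne' (Subtype.ext h')
        have := (hmem i₀).1
        exact Or.inr ((hpair _ _ (hmem i).2.1 (hmem i₀).2.2).1 (by omega))
  have hcard := hli.fintype_card_le_finrank
  rw [Module.finrank_fintype_fun_eq_card, Fintype.card_coe, ← Nat.card_eq_fintype_card,
    Nat.card_coe_set_eq] at hcard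
  have := le_card_semigroupPairs q w (by omega)
  omega

/-- Exponents of reduced monomials of weight less than `w`. -/
def reducedExps (q w : ℕ) : Set (Fin 2 →₀ ℕ) :=
  {d | d 0 ≤ q ∧ d 0 * q + d 1 * (q + 1) < w}

theorem precOrd_of_mem_reducedExps {q a b : ℕ} {d : Fin 2 →₀ ℕ}
    (hd : d ∈ reducedExps q (a * q + b * (q + 1))) : precOrd (expPair d) (a, b) := by
  obtain ⟨hr, hw⟩ := hd
  simp only [precOrd, expPair]
  generalize d 0 = r at *
  generalize d 1 = s at *
  by_contra! hcon
  obtain ⟨h1, h2⟩ := hcon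
  rcases Nat.lt_or_ge s b with hs | hs
  · obtain ⟨u, rfl⟩ := Nat.exists_eq_add_of_lt hs
    rcases h1.eq_or_lt with h1 | h1
    · have := h2 h1.symm
      omega
    · obtain ⟨t, rfl⟩ : ∃ t, r = a + u + 2 + t := ⟨r - (a + u + 2), by omega⟩
      nlinarith [Nat.zero_le (t * q)]
  · have := Nat.mul_le_mul_right q h1
    nlinarith

/-- A monomial outside the initial ideal of `D` does not agree on `D` with a combination of
reduced monomials of smaller weight. -/
theorem monEval_notMem_of_notMem_initialIdeal {q a b : ℕ} {D : Set (F × F)}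
    (hns : monoXY F a b ∉ initialIdealWith precOrd (vanIdeal F D)) :
    monEval D a b ∉
      (restrictSupport F (reducedExps q (a * q + b * (q + 1)))).map (evalOn D) := by
  rintro ⟨g, hg, hgab⟩
  rw [SetLike.mem_coe, mem_restrictSupport_iff] at hg
  apply hns
  have hcoeff : coeff (Finsupp.single 0 a + Finsupp.single 1 b) (monoXY F a b - g) ≠ 0 := by
    have hg0 : coeff (Finsupp.single 0 a + Finsupp.single 1 b) g = 0 := by
      by_contra hne
      have := (hg (mem_support_iff.mpr hne)).2
      simp at this
    simp [monoXY_eq_monomial, hg0]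
  refine Ideal.subset_span ⟨monoXY F a b - g, ?_, ?_, a, b, ⟨hcoeff, ?_⟩, rfl⟩
  · intro p hp
    rw [← evalOn_apply D _ ⟨p, hp⟩, map_sub, evalOn_monoXY, hgab, sub_self, Pi.zero_apply]
  · rintro h0
    simp [h0] at hcoeff
  · classical
    intro d hd
    rcases Finset.mem_union.mp (support_sub _ _ _ hd) with hd | hd
    · left
      rw [monoXY_eq_monomial] at hd
      have := Finset.mem_singleton.mp (support_monomial_subset hd)
      simp [this, expPair]
    · exact Or.inr (precOrd_of_mem_reducedExps (hg hd))

end HermitianMonomials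

theorem stmt_14 (q : ℕ) (hq2 : 2 ≤ q) (hq : IsPrimePow q)
    (F : Type) [Field F] [Fintype F] (hF : Fintype.card F = q ^ 2)
    (P : Fin (q ^ 3) → F × F) (hPinj : Function.Injective P)
    (hPrange : Set.range P = Eset F q)
    (m : ℕ) (hm : 2 * q ^ 2 - 2 * q - 2 ≤ m)
    (a b : ℕ) (hab : (a, b) ∈ Bset q)
    (hw1 : m + 1 ≤ a * q + b * (q + 1)) (hw2 : a * q + b * (q + 1) ≤ m + q + 1)
    (c : Fin (q ^ 3) → F) (hc : c ∈ codeSet F q m P) (hc0 : c ≠ 0)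
    (hns : monoXY F a b ∉ initialIdealWith precOrd (vanIdeal F (suppPts P c))) :
    a * q + b * (q + 1) + 1 ≤ (suppPts P c).ncard + (q ^ 2 - q) := by
  have haq : a ≤ q := by
    rcases hab with h | h
    · exact h.1
    · exact h.1.trans_le (Nat.zero_le q)
  have hD : suppPts P c ⊆ Eset F q := by
    rw [← hPrange]
    exact Set.image_subset_range _ _
  obtain ⟨ψ, hψ, hker⟩ := Submodule.exists_le_ker_of_notMem
    (monEval_notMem_of_notMem_initialIdeal (q := q) hns)
  have hred : ∀ r s, r ≤ q → r * q + s * (q + 1) < a * q + b * (q + 1) →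
      ψ (monEval (suppPts P c) r s) = 0 := by
    intro r s hr hw
    refine hker ⟨monoXY F r s, ?_, evalOn_monoXY _ r s⟩
    rw [SetLike.mem_coe, mem_restrictSupport_iff, monoXY_eq_monomial]
    intro d hd
    rw [Finset.mem_singleton.mp (support_monomial_subset hd)]
    simpa [reducedExps] using ⟨hr, hw⟩
  have hbound := order_bound hq2 hD ψ (dual_eq_zero_of_reduced hq2 hD ψ hred) rfl hψ
  rwa [Nat.mul_sub_one, ← sq] at hbound
end

section
/- Let m satisfy 2q^2 - 2q - 2 ≤ m ≤ n + 2g - 2 and suppose that B contains a monomial of weighted degree m+1. Then C_m contains a nonzero codeword, and the minimum weight of a nonzero codeword of C_m (the distance of C_m) equals m - q^2 + q + 2. -/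
open MvPolynomial

open Finset in
/-- The affine rational points of the Hermitian curve, as a finset. -/
def hermitianPoints (F : Type) [Field F] [Fintype F] [DecidableEq F] (q : ℕ) : Finset (F × F) :=
  univ.filter fun p => p.1 ^ (q + 1) = p.2 ^ q + p.2

section PointCounts

open Finset

variable {F : Type} [Field F] [Fintype F] [DecidableEq F] {q : ℕ}

lemma card_trace_fiber_le (hq2 : 2 ≤ q) (c : F) :
    (univ.filter fun y : F => c = y ^ q + y).card ≤ q := by
  have hdeg : (Polynomial.X ^ q + Polynomial.X - Polynomial.C c : Polynomial F).natDegree = q := by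
    compute_degree
    · have h1 : q ≠ 1 := by omega
      have h0 : q ≠ 0 := by omega
      simp [h1.symm, h0]
    all_goals omega
  have hne : (Polynomial.X ^ q + Polynomial.X - Polynomial.C c : Polynomial F) ≠ 0 := by
    intro h
    rw [h, Polynomial.natDegree_zero] at hdeg
    omega
  calc (univ.filter fun y : F => c = y ^ q + y).card
      ≤ (Polynomial.X ^ q + Polynomial.X - Polynomial.C c : Polynomial F).roots.toFinset.card := by
        refine card_le_card fun y hy => ?_
        rw [mem_filter] at hy
        rw [Multiset.mem_toFinset, Polynomial.mem_roots hne]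
        simp [← hy.2]
    _ ≤ _ := Multiset.toFinset_card_le _
    _ ≤ _ := Polynomial.card_roots' _
    _ = q := hdeg

lemma card_pow_fiber_le {k : ℕ} (hk : 0 < k) (t : F) :
    (univ.filter fun x : F => x ^ k = t).card ≤ k := by
  calc (univ.filter fun x : F => x ^ k = t).card
      ≤ (Polynomial.nthRoots k t).toFinset.card := by
        refine card_le_card fun x hx => ?_
        rw [mem_filter] at hx
        rw [Multiset.mem_toFinset, Polynomial.mem_nthRoots hk]
        exact hx.2
    _ ≤ _ := Multiset.toFinset_card_le _
    _ ≤ k := Polynomial.card_nthRoots _ _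

lemma sum_hermitianPoints_eq {M : Type} [AddCommMonoid M] (f : F × F → M) :
    ∑ p ∈ hermitianPoints F q, f p =
      ∑ x, ∑ y ∈ univ.filter (fun y : F => x ^ (q + 1) = y ^ q + y), f (x, y) := by
  simp only [hermitianPoints, sum_filter, Fintype.sum_prod_type]

lemma sum_hermitianPoints_eq' {M : Type} [AddCommMonoid M] (f : F × F → M) :
    ∑ p ∈ hermitianPoints F q, f p =
      ∑ y, ∑ x ∈ univ.filter (fun x : F => x ^ (q + 1) = y ^ q + y), f (x, y) := by
  simp only [hermitianPoints, sum_filter, Fintype.sum_prod_type_right]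

lemma card_trace_fiber_norm (hq2 : 2 ≤ q) (hF : Fintype.card F = q ^ 2)
    (hE : (hermitianPoints F q).card = q ^ 3) (a : F) :
    (univ.filter fun y : F => a ^ (q + 1) = y ^ q + y).card = q := by
  have hsum : ∑ x : F, (univ.filter fun y : F => x ^ (q + 1) = y ^ q + y).card
      = ∑ _x : F, q := by
    rw [card_eq_sum_ones, sum_hermitianPoints_eq] at hE
    simp only [← card_eq_sum_ones] at hE
    rw [hE, sum_const, card_univ, hF, smul_eq_mul]
    ring
  exact (sum_eq_sum_iff_of_le fun x _ => card_trace_fiber_le hq2 (x ^ (q + 1))).1 hsum a (mem_univ a)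

lemma card_trace_zero (hq2 : 2 ≤ q) (hF : Fintype.card F = q ^ 2)
    (hE : (hermitianPoints F q).card = q ^ 3) :
    (univ.filter fun y : F => y ^ q + y = 0).card = q := by
  simpa [eq_comm] using card_trace_fiber_norm hq2 hF hE 0

lemma card_trace_one (hq2 : 2 ≤ q) (hF : Fintype.card F = q ^ 2)
    (hE : (hermitianPoints F q).card = q ^ 3) :
    (univ.filter fun y : F => y ^ q + y = 1).card = q := by
  simpa [eq_comm] using card_trace_fiber_norm hq2 hF hE 1

lemma card_trace_ne_zero (hq2 : 2 ≤ q) (hF : Fintype.card F = q ^ 2)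
    (hE : (hermitianPoints F q).card = q ^ 3) :
    (univ.filter fun y : F => ¬ y ^ q + y = 0).card + q = q ^ 2 := by
  have := card_filter_add_card_filter_not (s := (univ : Finset F)) (fun y : F => y ^ q + y = 0)
  rw [card_trace_zero hq2 hF hE, card_univ, hF] at this
  omega

lemma card_trace_ne_zero_ne_one (hq2 : 2 ≤ q) (hF : Fintype.card F = q ^ 2)
    (hE : (hermitianPoints F q).card = q ^ 3) :
    q ^ 2 ≤ (univ.filter fun y : F => y ^ q + y ≠ 0 ∧ y ^ q + y ≠ 1).card + 2 * q := by
  have h0 := card_trace_ne_zero hq2 hF hE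
  have h1 := card_trace_one hq2 hF hE
  have hle : (univ.filter fun y : F => ¬ y ^ q + y = 0).card ≤
      ((univ.filter fun y : F => y ^ q + y ≠ 0 ∧ y ^ q + y ≠ 1) ∪
        univ.filter fun y : F => y ^ q + y = 1).card := by
    refine card_le_card fun y hy => ?_
    simp only [mem_filter, mem_univ, true_and, mem_union] at hy ⊢
    tauto
  have := hle.trans (card_union_le _ _)
  omega

lemma card_norm_fiber_trace (hq2 : 2 ≤ q) (hF : Fintype.card F = q ^ 2)
    (hE : (hermitianPoints F q).card = q ^ 3) {b : F} (hb : b ^ q + b ≠ 0) :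
    (univ.filter fun x : F => x ^ (q + 1) = b ^ q + b).card = q + 1 := by
  have hN0 : ∑ y ∈ univ.filter (fun y : F => y ^ q + y = 0),
      (univ.filter fun x : F => x ^ (q + 1) = y ^ q + y).card = q := by
    rw [sum_congr rfl (g := fun _ => 1), sum_const, card_trace_zero hq2 hF hE, smul_eq_mul, mul_one]
    intro y hy
    rw [mem_filter] at hy
    rw [card_eq_one]
    refine ⟨0, ?_⟩
    ext x
    simp [hy.2]
  have htot : ∑ y : F, (univ.filter fun x : F => x ^ (q + 1) = y ^ q + y).card = q ^ 3 := by
    rw [card_eq_sum_ones, sum_hermitianPoints_eq'] at hE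
    simpa only [card_eq_sum_ones] using hE
  rw [← sum_filter_add_sum_filter_not _ (fun y : F => y ^ q + y = 0), hN0] at htot
  have hsum : ∑ y ∈ univ.filter (fun y : F => ¬ y ^ q + y = 0),
      (univ.filter fun x : F => x ^ (q + 1) = y ^ q + y).card
      = ∑ _y ∈ univ.filter (fun y : F => ¬ y ^ q + y = 0), (q + 1) := by
    rw [sum_const, smul_eq_mul]
    have h := card_trace_ne_zero hq2 hF hE
    set k := (univ.filter fun y : F => ¬ y ^ q + y = 0).card
    have h2 : (k + q) * (q + 1) = q ^ 2 * (q + 1) := by rw [h]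
    nlinarith
  exact (sum_eq_sum_iff_of_le fun y _ => card_pow_fiber_le (Nat.succ_pos q) _).1 hsum b (by simp [hb])

lemma card_norm_one (hq2 : 2 ≤ q) (hF : Fintype.card F = q ^ 2)
    (hE : (hermitianPoints F q).card = q ^ 3) :
    (univ.filter fun x : F => x ^ (q + 1) = 1).card = q + 1 := by
  have h1 := card_trace_one hq2 hF hE
  obtain ⟨b, hb⟩ := card_pos.1 (show 0 < (univ.filter fun y : F => y ^ q + y = 1).card by omega)
  rw [mem_filter] at hb
  have := card_norm_fiber_trace hq2 hF hE (b := b) (by rw [hb.2]; exact one_ne_zero)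
  rwa [hb.2] at this

end PointCounts

lemma natCast_eq_zero_of_card_eq_sq {F : Type} [Field F] [Fintype F] {q : ℕ}
    (hF : Fintype.card F = q ^ 2) : (q : F) = 0 := by
  have h : ((q ^ 2 : ℕ) : F) = 0 := by
    rw [← hF]
    exact Nat.cast_card_eq_zero F
  rw [Nat.cast_pow] at h
  exact pow_eq_zero_iff (two_ne_zero) |>.1 h

section PowerSums

open Finset

variable {F : Type} [Field F] [Fintype F] [DecidableEq F] {q : ℕ}

lemma sum_monomial_eq_zero_of_lt (hq2 : 2 ≤ q) (hF : Fintype.card F = q ^ 2)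
    (hE : (hermitianPoints F q).card = q ^ 3) {r : ℕ} (hr0 : 0 < r) (hr : r < q + 1) (s : ℕ) :
    ∑ p ∈ hermitianPoints F q, p.1 ^ r * p.2 ^ s = 0 := by
  obtain ⟨z, hz1, hzr⟩ : ∃ z : F, z ^ (q + 1) = 1 ∧ z ^ r ≠ 1 := by
    by_contra! h
    have hle : (univ.filter fun x : F => x ^ (q + 1) = 1).card ≤
        (univ.filter fun x : F => x ^ r = 1).card := by
      refine card_le_card fun x hx => ?_
      simp only [mem_filter, mem_univ, true_and] at hx ⊢
      exact h x hx
    rw [card_norm_one hq2 hF hE] at hle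
    have := hle.trans (card_pow_fiber_le hr0 1)
    omega
  have hz0 : z ≠ 0 := by
    rintro rfl
    simp at hz1
  have key : ∑ p ∈ hermitianPoints F q, p.1 ^ r * p.2 ^ s =
      z ^ r * ∑ p ∈ hermitianPoints F q, p.1 ^ r * p.2 ^ s := by
    rw [mul_sum]
    symm
    refine sum_bij' (fun p _ => (z * p.1, p.2)) (fun p _ => (z⁻¹ * p.1, p.2)) ?_ ?_ ?_ ?_ ?_
    · intro p hp
      simpa [hermitianPoints, mul_pow, hz1] using hp
    · intro p hp
      simpa [hermitianPoints, mul_pow, hz1] using hp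
    · intro p _
      simp [hz0]
    · intro p _
      simp [hz0]
    · intro p _
      simp only [mul_pow]
      ring
  have : (1 - z ^ r) * ∑ p ∈ hermitianPoints F q, p.1 ^ r * p.2 ^ s = 0 := by
    rw [sub_mul, one_mul, ← key, sub_self]
  exact (mul_eq_zero.1 this).resolve_left (sub_ne_zero.2 hzr.symm)

lemma sum_snd_pow_eq_zero (hq2 : 2 ≤ q) (hF : Fintype.card F = q ^ 2)
    (hE : (hermitianPoints F q).card = q ^ 3) {s : ℕ} (hs : s < q ^ 2 - 1) :
    ∑ p ∈ hermitianPoints F q, p.2 ^ s = 0 := by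
  rw [sum_hermitianPoints_eq']
  simp only [sum_const, nsmul_eq_mul]
  rw [← FiniteField.sum_pow_lt_card_sub_one F s (by rwa [hF])]
  refine sum_congr rfl fun y _ => ?_
  by_cases hy : y ^ q + y = 0
  · have : (univ.filter fun x : F => x ^ (q + 1) = y ^ q + y) = {0} := by
      ext x
      simp [hy]
    simp [this]
  · rw [card_norm_fiber_trace hq2 hF hE hy]
    simp [natCast_eq_zero_of_card_eq_sq hF]

lemma sum_monomial_eq_zero (hq2 : 2 ≤ q) (hF : Fintype.card F = q ^ 2)
    (hE : (hermitianPoints F q).card = q ^ 3) (r s : ℕ)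
    (hw : r * q + s * (q + 1) < (q + 1) * (q ^ 2 - 1)) :
    ∑ p ∈ hermitianPoints F q, p.1 ^ r * p.2 ^ s = 0 := by
  induction r using Nat.strong_induction_on generalizing s with
  | _ r ih =>
    rcases Nat.eq_zero_or_pos r with rfl | hr0
    · simp only [pow_zero, one_mul]
      refine sum_snd_pow_eq_zero hq2 hF hE ?_
      have : (q + 1) * s < (q + 1) * (q ^ 2 - 1) := by linarith
      exact lt_of_mul_lt_mul_left this (Nat.zero_le _)
    · rcases lt_or_ge r (q + 1) with hr | hr
      · exact sum_monomial_eq_zero_of_lt hq2 hF hE hr0 hr s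
      · obtain ⟨k, rfl⟩ := Nat.exists_eq_add_of_le hr
        have h1 := ih k (by omega) (s + q) (by nlinarith)
        have h2 := ih k (by omega) (s + 1) (by nlinarith)
        rw [← add_zero (0 : F)]
        nth_rewrite 1 [← h1]
        rw [← h2, ← sum_add_distrib]
        refine sum_congr rfl fun p hp => ?_
        rw [hermitianPoints, mem_filter] at hp
        rw [pow_add, hp.2]
        ring

lemma sum_monomial_mul_prod_eq_zero (hq2 : 2 ≤ q) (hF : Fintype.card F = q ^ 2)
    (hE : (hermitianPoints F q).card = q ^ 3) (A B : Finset F) (r s : ℕ)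
    (hw : r * q + s * (q + 1) + (A.card * q + B.card * (q + 1)) < (q + 1) * (q ^ 2 - 1)) :
    ∑ p ∈ hermitianPoints F q,
      (∏ a ∈ A, (p.1 - a)) * (∏ b ∈ B, (p.2 - b)) * (p.1 ^ r * p.2 ^ s) = 0 := by
  induction A using Finset.induction_on generalizing r s with
  | empty =>
    induction B using Finset.induction_on generalizing r s with
    | empty =>
      simpa using sum_monomial_eq_zero hq2 hF hE r s (by simpa using hw)
    | insert b B hb ih =>
      rw [card_insert_of_notMem hb] at hw
      have h1 := ih r (s + 1) (by nlinarith)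
      have h2 := ih r s (by nlinarith)
      rw [← sub_zero (0 : F)]
      nth_rewrite 1 [← h1]
      rw [← mul_zero b, ← h2, mul_sum, ← sum_sub_distrib]
      refine sum_congr rfl fun p _ => ?_
      rw [prod_insert hb]
      ring
  | insert a A ha ih =>
    rw [card_insert_of_notMem ha] at hw
    have h1 := ih (r + 1) s (by nlinarith)
    have h2 := ih r s (by nlinarith)
    rw [← sub_zero (0 : F)]
    nth_rewrite 1 [← h1]
    rw [← mul_zero a, ← h2, mul_sum, ← sum_sub_distrib]
    refine sum_congr rfl fun p _ => ?_
    rw [prod_insert ha]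
    ring

lemma card_hermitianPoints_filter_mem (hq2 : 2 ≤ q) (hF : Fintype.card F = q ^ 2)
    (hE : (hermitianPoints F q).card = q ^ 3) (A B : Finset F)
    (hB : ∀ b ∈ B, b ^ q + b ≠ 0) (hAB : ∀ a ∈ A, ∀ b ∈ B, a ^ (q + 1) ≠ b ^ q + b) :
    ((hermitianPoints F q).filter fun p => p.1 ∈ A ∨ p.2 ∈ B).card =
      A.card * q + B.card * (q + 1) := by
  rw [filter_or, card_union_of_disjoint]
  · congr 1
    · rw [card_filter, sum_hermitianPoints_eq]
      rw [sum_congr rfl fun x _ => sum_const (if x ∈ A then 1 else 0)]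
      simp only [card_trace_fiber_norm hq2 hF hE]
      simp [mul_comm]
    · rw [card_filter, sum_hermitianPoints_eq']
      rw [sum_congr rfl fun y _ => sum_const (if y ∈ B then 1 else 0)]
      simp only [smul_eq_mul, mul_ite, mul_one, mul_zero]
      rw [← sum_filter, filter_univ_mem,
        sum_congr rfl fun b hb => card_norm_fiber_trace hq2 hF hE (hB b hb)]
      simp
  · rw [disjoint_left]
    intro p hp hp'
    simp only [hermitianPoints, mem_filter, mem_univ, true_and] at hp hp'
    exact hAB _ hp.2 _ hp'.2 hp.1

lemma exists_disjoint_lines (hq2 : 2 ≤ q) (hF : Fintype.card F = q ^ 2)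
    (hE : (hermitianPoints F q).card = q ^ 3) {a b : ℕ}
    (hab : (a ≤ 1 ∧ b + q ≤ q ^ 2) ∨ (a ≤ q + 1 ∧ b + 2 * q ≤ q ^ 2)) :
    ∃ A B : Finset F, A.card = a ∧ B.card = b ∧ (∀ y ∈ B, y ^ q + y ≠ 0) ∧
      ∀ x ∈ A, ∀ y ∈ B, x ^ (q + 1) ≠ y ^ q + y := by
  rcases hab with ⟨ha, hb⟩ | ⟨ha, hb⟩
  · obtain ⟨A, hA, rfl⟩ := exists_subset_card_eq (s := {(0 : F)}) (n := a) (by simpa using ha)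
    obtain ⟨B, hB, rfl⟩ := exists_subset_card_eq (s := univ.filter fun y : F => ¬ y ^ q + y = 0)
      (n := b) (by have := card_trace_ne_zero hq2 hF hE; omega)
    refine ⟨A, B, rfl, rfl, fun y hy => (mem_filter.1 (hB hy)).2, fun x hx y hy => ?_⟩
    rw [mem_singleton.1 (hA hx)]
    simpa using (Ne.symm (mem_filter.1 (hB hy)).2)
  · obtain ⟨A, hA, rfl⟩ := exists_subset_card_eq (s := univ.filter fun x : F => x ^ (q + 1) = 1)
      (n := a) (by have := card_norm_one hq2 hF hE; omega)
    obtain ⟨B, hB, rfl⟩ := exists_subset_card_eq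
      (s := univ.filter fun y : F => y ^ q + y ≠ 0 ∧ y ^ q + y ≠ 1)
      (n := b) (by have := card_trace_ne_zero_ne_one hq2 hF hE; omega)
    refine ⟨A, B, rfl, rfl, fun y hy => (mem_filter.1 (hB hy)).2.1, fun x hx y hy => ?_⟩
    rw [(mem_filter.1 (hA hx)).2]
    exact (mem_filter.1 (hB hy)).2.2.symm

end PowerSums

/-- The reflection `w ↦ (q + 1)(q² - 1) - w` of the weights of `B`, with bounds on the exponents of
the reflected monomial. -/
lemma exists_dual_exponents {q m : ℕ} (hq2 : 2 ≤ q) (hm1 : 2 * q ^ 2 - 2 * q - 2 ≤ m)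
    (hB : ∃ p ∈ Bset q, p.1 * q + p.2 * (q + 1) = m + 1) :
    ∃ a b : ℕ, a * q + b * (q + 1) + m + 1 = (q + 1) * (q ^ 2 - 1) ∧
      ((a ≤ 1 ∧ b + q ≤ q ^ 2) ∨ (a ≤ q + 1 ∧ b + 2 * q ≤ q ^ 2)) := by
  obtain ⟨⟨r, s⟩, hp, hw⟩ := hB
  simp only [Bset, Set.mem_ofPred_eq] at hp hw
  have hqq : 2 * q ≤ q ^ 2 := by nlinarith
  obtain ⟨t, ht⟩ := Nat.exists_eq_add_of_le hqq
  have h1 : 2 * q ^ 2 ≤ m + 2 * q + 2 := by omega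
  by_cases hr : r = 0
  · subst hr
    have hs : s ≤ q ^ 2 - 1 := by omega
    have hs' : q ≤ s + 1 := by
      by_contra! h
      nlinarith
    obtain ⟨b, hb⟩ := Nat.exists_eq_add_of_le hs
    refine ⟨0, b, ?_, Or.inl ⟨by omega, by omega⟩⟩
    rw [hb]
    nlinarith
  · have hrs : r ≤ q ∧ s ≤ q ^ 2 - q - 1 := by omega
    obtain ⟨a, ha⟩ := Nat.exists_eq_add_of_le (show r ≤ q + 1 by omega)
    obtain ⟨b, hb⟩ := Nat.exists_eq_add_of_le hrs.2
    have hb' : q ^ 2 = s + b + q + 1 := by omega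
    refine ⟨a, b, ?_, ?_⟩
    · have : q ^ 2 - 1 = s + b + q := by omega
      rw [this]
      nlinarith
    · by_cases ha1 : a ≤ 1
      · exact Or.inl ⟨ha1, by omega⟩
      · right
        refine ⟨by omega, ?_⟩
        have hs' : q ≤ s + 1 := by
          by_contra! h
          have hr' : r + 1 ≤ q := by omega
          nlinarith
        omega

section OrderBound

open Finset

lemma two_mul_card_gaps_le {q : ℕ} (hq : 0 < q) (G : Finset ℕ)
    (hG : ∀ l ∈ G, l / q < l % q) : 2 * G.card ≤ q * (q - 1) := by
  have hsub : G.card ≤ ((range q).sigma fun j => range j).card := by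
    refine card_le_card_of_injOn (fun l => (⟨l % q, l / q⟩ : (_ : ℕ) × ℕ)) ?_ ?_
    · intro l hl
      simp only [coe_sigma, Set.mem_sigma_iff, coe_range, Set.mem_Iio]
      exact ⟨Nat.mod_lt _ hq, hG l hl⟩
    · intro l _ l' _ h
      simp only [Sigma.mk.injEq, heq_eq_eq] at h
      rw [← Nat.div_add_mod l q, ← Nat.div_add_mod l' q, h.1, h.2]
  rw [card_sigma] at hsub
  simp only [card_range] at hsub
  have := Finset.sum_range_id_mul_two q
  omega

lemma le_card_sub_gaps {q : ℕ} (hq : 0 < q) (μ : ℕ) :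
    μ + 1 ≤ ((range (μ + 1)).filter fun l => l % q ≤ l / q ∧ (μ - l) % q ≤ (μ - l) / q).card
      + q * (q - 1) := by
  set R := range (μ + 1)
  have h1 := two_mul_card_gaps_le hq (R.filter fun l => l / q < l % q) (by simp)
  have h2 : (R.filter fun l => (μ - l) / q < (μ - l) % q).card ≤
      (R.filter fun l => l / q < l % q).card := by
    refine card_le_card_of_injOn (fun l => μ - l) ?_ ?_
    · intro l hl
      simp only [R, coe_filter, Finset.mem_range, Set.mem_ofPred_eq] at hl ⊢
      exact ⟨by omega, hl.2⟩
    · intro l hl l' hl' h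
      simp only [R, coe_filter, Finset.mem_range, Set.mem_ofPred_eq] at hl hl' h
      omega
  have h3 : R ⊆ (R.filter fun l => l % q ≤ l / q ∧ (μ - l) % q ≤ (μ - l) / q) ∪
      ((R.filter fun l => l / q < l % q) ∪ R.filter fun l => (μ - l) / q < (μ - l) % q) := by
    intro l hl
    simp only [mem_union, mem_filter, hl, true_and]
    omega
  have h4 := card_le_card h3
  have h5 := card_union_le (R.filter fun l => l % q ≤ l / q ∧ (μ - l) % q ≤ (μ - l) / q)
      ((R.filter fun l => l / q < l % q) ∪ R.filter fun l => (μ - l) / q < (μ - l) % q)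
  have h6 := card_union_le (R.filter fun l => l / q < l % q)
    (R.filter fun l => (μ - l) / q < (μ - l) % q)
  have h7 : R.card = μ + 1 := card_range _
  omega

variable {F : Type} [Field F] {ι : Type} [Fintype ι] {q : ℕ}

/-- The syndrome of a vector `c` at the monomial `x^r y^s`. -/
def syndrome (P : ι → F × F) (c : ι → F) (r s : ℕ) : F :=
  ∑ i, c i * ((P i).1 ^ r * (P i).2 ^ s)

lemma exists_syndrome_ne_zero [Fintype F] {P : ι → F × F} (hP : Function.Injective P) {c : ι → F}
    (hc : c ≠ 0) : ∃ r s, syndrome P c r s ≠ 0 := by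
  by_contra! h
  obtain ⟨j, hj⟩ := Function.ne_iff.1 hc
  have hpoly : ∀ f : MvPolynomial (Fin 2) F, ∑ i, c i * eval ![(P i).1, (P i).2] f = 0 := by
    intro f
    induction f using MvPolynomial.induction_on' with
    | monomial u a =>
      have := h (u 0) (u 1)
      rw [syndrome] at this
      rw [← mul_zero a, ← this, mul_sum]
      refine sum_congr rfl fun i _ => ?_
      rw [eval_monomial, Finsupp.prod_fintype _ _ (by simp)]
      simp
      ring
    | add f g hf hg =>
      simp [mul_add, sum_add_distrib, hf, hg]
  have := hpoly (indicator ![(P j).1, (P j).2])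
  rw [sum_eq_single j] at this
  · rw [eval_indicator_apply_eq_one, mul_one] at this
    exact hj this
  · intro i _ hij
    rw [eval_indicator_apply_eq_zero, mul_zero]
    intro h
    refine hij (hP (Prod.ext ?_ ?_))
    · simpa using congrFun h 0
    · simpa using congrFun h 1
  · simp

lemma syndrome_add_left {P : ι → F × F} (hPE : ∀ i, (P i).1 ^ (q + 1) = (P i).2 ^ q + (P i).2)
    (c : ι → F) (r s : ℕ) :
    syndrome P c (q + 1 + r) s = syndrome P c r (s + q) + syndrome P c r (s + 1) := by
  simp only [syndrome, ← sum_add_distrib]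
  refine sum_congr rfl fun i _ => ?_
  rw [pow_add, hPE]
  ring

lemma syndrome_eq_mod {P : ι → F × F} (hq : 2 ≤ q)
    (hPE : ∀ i, (P i).1 ^ (q + 1) = (P i).2 ^ q + (P i).2) {c : ι → F} {μ : ℕ}
    (hμ : ∀ r s, r * q + s * (q + 1) < μ → syndrome P c r s = 0) (r s : ℕ)
    (hrs : r * q + s * (q + 1) = μ) :
    ∃ r' s', r' ≤ q ∧ r' * q + s' * (q + 1) = μ ∧ syndrome P c r s = syndrome P c r' s' := by
  induction r using Nat.strong_induction_on generalizing s with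
  | _ r ih =>
    rcases lt_or_ge r (q + 1) with hr | hr
    · exact ⟨r, s, by omega, hrs, rfl⟩
    · obtain ⟨k, rfl⟩ := Nat.exists_eq_add_of_le hr
      obtain ⟨r', s', h1, h2, h3⟩ := ih k (by omega) (s + q) (by nlinarith)
      refine ⟨r', s', h1, h2, ?_⟩
      rw [syndrome_add_left hPE, h3, hμ k (s + 1) (by nlinarith), add_zero]

lemma weight_ne_of_lt {r s r' s' : ℕ} (hr' : r' ≤ q) (hlt : r < r') :
    r * q + s * (q + 1) ≠ r' * q + s' * (q + 1) := by
  intro h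
  obtain ⟨k, rfl⟩ := Nat.exists_eq_add_of_lt hlt
  rcases le_or_gt s (s' + k) with hs | hs
  · have := Nat.mul_le_mul_right (q + 1) hs
    nlinarith
  · have := Nat.mul_le_mul_right (q + 1) (Nat.succ_le_of_lt hs)
    nlinarith

lemma weight_injective {r s r' s' : ℕ} (hr : r ≤ q) (hr' : r' ≤ q)
    (h : r * q + s * (q + 1) = r' * q + s' * (q + 1)) : r = r' ∧ s = s' := by
  rcases lt_trichotomy r r' with hlt | rfl | hlt
  · exact absurd h (weight_ne_of_lt hr' hlt)
  · exact ⟨rfl, Nat.eq_of_mul_eq_mul_right (Nat.succ_pos q) (Nat.add_left_cancel h)⟩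
  · exact absurd h.symm (weight_ne_of_lt hr hlt)

lemma syndrome_eq_of_weight_eq {P : ι → F × F} (hq : 2 ≤ q)
    (hPE : ∀ i, (P i).1 ^ (q + 1) = (P i).2 ^ q + (P i).2) {c : ι → F} {μ : ℕ}
    (hμ : ∀ r s, r * q + s * (q + 1) < μ → syndrome P c r s = 0) {r s r' s' : ℕ}
    (h : r * q + s * (q + 1) = μ) (h' : r' * q + s' * (q + 1) = μ) :
    syndrome P c r s = syndrome P c r' s' := by
  obtain ⟨a, b, ha, hab, e⟩ := syndrome_eq_mod hq hPE hμ r s h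
  obtain ⟨a', b', ha', hab', e'⟩ := syndrome_eq_mod hq hPE hμ r' s' h'
  obtain ⟨rfl, rfl⟩ := weight_injective ha ha' (hab.trans hab'.symm)
  rw [e, e']

lemma weight_div_mod {l : ℕ} (h : l % q ≤ l / q) :
    (l / q - l % q) * q + l % q * (q + 1) = l := by
  obtain ⟨k, hk⟩ := Nat.exists_eq_add_of_le h
  have := Nat.div_add_mod l q
  rw [hk] at this ⊢
  rw [Nat.add_sub_cancel_left]
  nlinarith

/-- The order bound: if `μ` is the least weight of a monomial with nonzero syndrome, then the
support of `c` has at least as many elements as there are ways to write `μ` as a sum of two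
weights. -/
lemma card_le_card_support [DecidableEq F] {P : ι → F × F} (hq : 2 ≤ q)
    (hPE : ∀ i, (P i).1 ^ (q + 1) = (P i).2 ^ q + (P i).2) {c : ι → F} {r₀ s₀ : ℕ}
    (hne : syndrome P c r₀ s₀ ≠ 0)
    (hμ : ∀ r s, r * q + s * (q + 1) < r₀ * q + s₀ * (q + 1) → syndrome P c r s = 0) :
    ((range (r₀ * q + s₀ * (q + 1) + 1)).filter fun l =>
      l % q ≤ l / q ∧
        (r₀ * q + s₀ * (q + 1) - l) % q ≤ (r₀ * q + s₀ * (q + 1) - l) / q).card ≤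
      (univ.filter fun i => c i ≠ 0).card := by
  set μ := r₀ * q + s₀ * (q + 1)
  set T := (range (μ + 1)).filter fun l => l % q ≤ l / q ∧ (μ - l) % q ≤ (μ - l) / q
  let φ : ℕ → F × F → F := fun l p => p.1 ^ (l / q - l % q) * p.2 ^ (l % q)
  have hφ : ∀ l l', ∑ i, c i * (φ l (P i) * φ l' (P i)) =
      syndrome P c (l / q - l % q + (l' / q - l' % q)) (l % q + l' % q) := by
    intro l l'
    refine sum_congr rfl fun i _ => ?_
    simp only [φ, pow_add]
    ring
  have hweight : ∀ l l', l % q ≤ l / q → l' % q ≤ l' / q →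
      (l / q - l % q + (l' / q - l' % q)) * q + (l % q + l' % q) * (q + 1) = l + l' := by
    intro l l' h h'
    have e := weight_div_mod h
    have e' := weight_div_mod h'
    rw [add_mul, add_mul]
    omega
  let v : T → {i // c i ≠ 0} → F := fun l i => φ l (P i)
  have hli : LinearIndependent F v := by
    rw [Fintype.linearIndependent_iff]
    intro g hg
    by_contra! hex
    obtain ⟨k, hk, hmax⟩ := exists_max_image (univ.filter fun l : T => g l ≠ 0) (fun l => (l : ℕ))
      (by obtain ⟨i, hi⟩ := hex; exact ⟨i, by simp [hi]⟩)
    simp only [mem_filter, mem_univ, true_and] at hk hmax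
    have hT : ∀ l : T, (l : ℕ) ≤ μ ∧ (l : ℕ) % q ≤ l / q ∧ (μ - l) % q ≤ (μ - l) / q := by
      intro l
      have := l.2
      simp only [T, mem_filter, Finset.mem_range] at this
      exact ⟨by omega, this.2⟩
    have hpt : ∀ i, c i ≠ 0 → ∑ l : T, g l * φ l (P i) = 0 := by
      intro i hi
      simpa [v] using congrFun hg ⟨i, hi⟩
    have hzero : ∑ l : T, g l * ∑ i, c i * (φ l (P i) * φ (μ - k) (P i)) = 0 := by
      simp only [mul_sum]
      rw [sum_comm]
      refine sum_eq_zero fun i _ => ?_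
      by_cases hi : c i = 0
      · simp [hi]
      · have : ∑ l : T, g l * (c i * (φ l (P i) * φ (μ - k) (P i))) =
            c i * φ (μ - k) (P i) * ∑ l : T, g l * φ l (P i) := by
          rw [mul_sum]
          exact sum_congr rfl fun l _ => by ring
        rw [this, hpt i hi, mul_zero]
    rw [sum_eq_single k] at hzero
    · rw [hφ] at hzero
      have hw := hweight k (μ - k) (hT k).2.1 (hT k).2.2
      rw [syndrome_eq_of_weight_eq hq hPE hμ (r' := r₀) (s' := s₀)
        (hw.trans (by have := (hT k).1; omega)) rfl] at hzero
      exact (mul_ne_zero hk hne) hzero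
    · intro l _ hlk
      by_cases hgl : g l = 0
      · rw [hgl, zero_mul]
      · have hlt : (l : ℕ) < k := lt_of_le_of_ne (hmax l hgl) fun h => hlk (Subtype.ext h)
        have hw := hweight l (μ - k) (hT l).2.1 (hT k).2.2
        rw [hφ, hμ, mul_zero]
        rw [hw]
        have := (hT k).1
        omega
    · simp
  have := hli.fintype_card_le_finrank
  rw [Module.finrank_fintype_fun_eq_card, Fintype.card_coe, Fintype.card_subtype] at this
  exact this

end OrderBound

theorem stmt_16 (q : ℕ) (hq2 : 2 ≤ q) (hq : IsPrimePow q)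
    (F : Type) [Field F] [Fintype F] (hF : Fintype.card F = q ^ 2)
    (P : Fin (q ^ 3) → F × F) (hPinj : Function.Injective P)
    (hPrange : Set.range P = Eset F q)
    (m : ℕ) (hm1 : 2 * q ^ 2 - 2 * q - 2 ≤ m) (hm2 : m ≤ q ^ 3 + q * (q - 1) - 2)
    (hB : ∃ p ∈ Bset q, p.1 * q + p.2 * (q + 1) = m + 1) :
    ∀ d : ℕ, d + q ^ 2 = m + q + 2 →
      IsLeast {w : ℕ | ∃ c ∈ codeSet F q m P, c ≠ 0 ∧ wt c = w} d := by
  classical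
  intro d hd
  have hPE : ∀ i, (P i).1 ^ (q + 1) = (P i).2 ^ q + (P i).2 := fun i => by
    have : P i ∈ Eset F q := hPrange ▸ Set.mem_range_self i
    exact this
  have himage : Finset.univ.image P = hermitianPoints F q := by
    ext p
    have : p ∈ Set.range P ↔ p ∈ Eset F q := by rw [hPrange]
    simpa [hermitianPoints, Eset] using this
  have hE : (hermitianPoints F q).card = q ^ 3 := by
    rw [← himage, Finset.card_image_of_injective _ hPinj, Finset.card_univ, Fintype.card_fin]
  have hwt : ∀ c : Fin (q ^ 3) → F, wt c = (Finset.univ.filter fun i => c i ≠ 0).card := by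
    intro c
    rw [wt, Set.ncard_eq_toFinset_card', Set.toFinset_ofPred]
  have hqsq : q * (q - 1) + q = q ^ 2 := by
    obtain ⟨k, rfl⟩ := Nat.exists_eq_add_of_le (show 1 ≤ q by omega)
    rw [Nat.add_sub_cancel_left]
    ring
  refine ⟨?_, ?_⟩
  · obtain ⟨a, b, hab, hbounds⟩ := exists_dual_exponents hq2 hm1 hB
    obtain ⟨A, B, rfl, rfl, hB0, hAB⟩ := exists_disjoint_lines (F := F) hq2 hF hE hbounds
    let c : Fin (q ^ 3) → F := fun i => (∏ a ∈ A, ((P i).1 - a)) * ∏ b ∈ B, ((P i).2 - b)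
    have hmem : c ∈ codeSet F q m P := by
      intro r s hrs
      rw [← sum_monomial_mul_prod_eq_zero hq2 hF hE A B r s (by omega), ← himage,
        Finset.sum_image hPinj.injOn]
    have hzeros : (Finset.univ.filter fun i => ¬ c i ≠ 0).card =
        A.card * q + B.card * (q + 1) := by
      rw [← card_hermitianPoints_filter_mem hq2 hF hE A B hB0 hAB, ← himage, Finset.filter_image,
        Finset.card_image_of_injective _ hPinj]
      congr 1
      ext i
      simp only [c, Finset.mem_filter, Finset.mem_univ, true_and, not_not, mul_eq_zero,
        Finset.prod_eq_zero_iff, sub_eq_zero, exists_eq_right']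
    have hcw : wt c = d := by
      have h := Finset.card_filter_add_card_filter_not (s := (Finset.univ : Finset (Fin (q ^ 3))))
        (fun i => c i ≠ 0)
      rw [hzeros, Finset.card_univ, Fintype.card_fin, ← hwt] at h
      have : (q + 1) * (q ^ 2 - 1) + q + 1 = q ^ 3 + q ^ 2 := by
        obtain ⟨k, hk⟩ := Nat.exists_eq_add_of_le (show 1 ≤ q ^ 2 by nlinarith)
        rw [pow_succ q 2, hk, Nat.add_sub_cancel_left]
        ring
      omega
    refine ⟨c, hmem, ?_, hcw⟩
    intro hc0
    have : wt c = 0 := by simp [hwt, hc0]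
    have : 2 * q ≤ q ^ 2 := by nlinarith
    omega
  · rintro w ⟨c, hc, hc0, rfl⟩
    have hex : ∃ μ r s, r * q + s * (q + 1) = μ ∧ syndrome P c r s ≠ 0 := by
      obtain ⟨r, s, h⟩ := exists_syndrome_ne_zero hPinj hc0
      exact ⟨_, r, s, rfl, h⟩
    obtain ⟨r, s, hrs, hne⟩ := Nat.find_spec hex
    have hmin : ∀ r' s', r' * q + s' * (q + 1) < r * q + s * (q + 1) →
        syndrome P c r' s' = 0 := by
      intro r' s' h
      by_contra h0
      exact Nat.find_min hex (hrs ▸ h) ⟨r', s', rfl, h0⟩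
    have hm : m < r * q + s * (q + 1) := by
      by_contra! h
      exact hne (hc r s h)
    have h1 := card_le_card_support hq2 hPE hne hmin
    have h2 := le_card_sub_gaps (show 0 < q by omega) (r * q + s * (q + 1))
    rw [hwt]
    omega
end
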